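/- Let n ≥ 4 and let P_± = (I ± Γ_{1_{2n}})/2 on (ℂ²)^{⊗n}, where 1_{2n} ∈ F₂^{2n} is the all-ones vector. Suppose Q is a nonzero orthogonal projection whose range is contained in the range of P_+ (respectively P_−), such that for every x ∈ F₂^{2n} with wt(x) = 2 there exists ε ∈ ℂ with Q Γ_x Q = ε Q (i.e., Q is an 𝔰𝔬(2n) semispinorial code of minimum distance at least 2). Then n · rank Q ≤ 2^{n−2} if n is even, and (n² − 1) · rank Q ≤ (n − 2) · 2^{n−2} if n is odd. -/

import Mathlib

noncomputable section

open Matrix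

/-- The Pauli matrix `σ_x`. -/
def pauliX : Matrix (Fin 2) (Fin 2) ℂ := !![0, 1; 1, 0]

/-- The Pauli matrix `σ_y`. -/
def pauliY : Matrix (Fin 2) (Fin 2) ℂ := !![0, -Complex.I; Complex.I, 0]

/-- The Pauli matrix `σ_z`. -/
def pauliZ : Matrix (Fin 2) (Fin 2) ℂ := !![1, 0; 0, -1]

/-- The single-site factor of the `k`-th Weyl–Brauer matrix (with `k` 1-based and
site `i` 0-based): for `1 ≤ k ≤ n` it is `σ_z` on sites before site `k`, `σ_x` at
site `k`, and the identity afterwards; for `n+1 ≤ k ≤ 2n` the same with `σ_y` at site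
`k - n`; and for `k = 2n+1` it is `σ_z` everywhere. -/
def wbFactor (n k i : ℕ) : Matrix (Fin 2) (Fin 2) ℂ :=
  if k ≤ n then (if i + 1 < k then pauliZ else if i + 1 = k then pauliX else 1)
  else if k ≤ 2 * n then
    (if i + 1 < k - n then pauliZ else if i + 1 = k - n then pauliY else 1)
  else pauliZ

/-- The `k`-th Weyl–Brauer matrix on `(ℂ²)^{⊗n}` (with `k` 1-based, `1 ≤ k ≤ 2n+1`),
realized as a matrix indexed by `Fin n → Fin 2`:
`U_k = σ_z^{⊗(k−1)} ⊗ σ_x ⊗ I₂^{⊗(n−k)}`, `U_{n+k} = σ_z^{⊗(k−1)} ⊗ σ_y ⊗ I₂^{⊗(n−k)}`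
for `1 ≤ k ≤ n`, and `U_{2n+1} = σ_z^{⊗n}`. -/
def weylBrauer (n k : ℕ) : Matrix (Fin n → Fin 2) (Fin n → Fin 2) ℂ :=
  Matrix.of fun a b => ∏ i : Fin n, wbFactor n k (i : ℕ) (a i) (b i)

/-- The Hamming weight of a binary vector: the number of nonzero components. -/
def wtZ {l : ℕ} (x : Fin l → ZMod 2) : ℕ :=
  (Finset.filter (fun i => x i ≠ 0) Finset.univ).card

/-- `τ(x) = wt(x)(wt(x) − 1)/2`. -/
def tauZ {l : ℕ} (x : Fin l → ZMod 2) : ℕ := wtZ x * (wtZ x - 1) / 2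

/-- The `k`-th (0-based) component of `x` as a natural number (`0` or `1`), with the
convention that it is `0` out of range. -/
def xcomp {l : ℕ} (x : Fin l → ZMod 2) (k : ℕ) : ℕ :=
  if h : k < l then (x ⟨k, h⟩).val else 0

/-- The Clifford operator `Γ_x` on `(ℂ²)^{⊗n}` for `x ∈ F₂^l`, intended for `l = 2n`
(even case) or `l = 2n+1` (odd case):
`Γ_x = i^{τ(x)} (∏_{k=1}^{n} U_k^{x_k} U_{n+k}^{x_{n+k}}) U_{2n+1}^{x_{2n+1}}`,
the product taken over `k` in increasing order, where the final factor
`U_{2n+1}^{x_{2n+1}}` is `1` when `l = 2n`. -/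
def gammaOp (n l : ℕ) (x : Fin l → ZMod 2) : Matrix (Fin n → Fin 2) (Fin n → Fin 2) ℂ :=
  (Complex.I ^ tauZ x) •
    ((((List.finRange n).map fun k =>
        weylBrauer n ((k : ℕ) + 1) ^ xcomp x (k : ℕ) *
          weylBrauer n (n + (k : ℕ) + 1) ^ xcomp x (n + (k : ℕ))).prod) *
      weylBrauer n (2 * n + 1) ^ xcomp x (2 * n))


/-- Tensor product of single-site matrices. -/
def pmat {n : ℕ} (f : Fin n → Matrix (Fin 2) (Fin 2) ℂ) :
    Matrix (Fin n → Fin 2) (Fin n → Fin 2) ℂ :=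
  Matrix.of fun a b => ∏ i : Fin n, f i (a i) (b i)

lemma pmat_mul {n : ℕ} (f g : Fin n → Matrix (Fin 2) (Fin 2) ℂ) :
    pmat f * pmat g = pmat (fun i => f i * g i) := by
  ext a b
  simp only [pmat, Matrix.mul_apply, Matrix.of_apply]
  rw [Finset.prod_univ_sum]
  simp [Finset.prod_mul_distrib]

lemma pmat_one {n : ℕ} : pmat (fun _ : Fin n => (1 : Matrix (Fin 2) (Fin 2) ℂ)) = 1 := by
  ext a b
  simp only [pmat, Matrix.of_apply, Matrix.one_apply]
  rw [Finset.prod_ite_zero]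
  simp [funext_iff]

lemma pmat_herm {n : ℕ} (f : Fin n → Matrix (Fin 2) (Fin 2) ℂ) :
    (pmat f)ᴴ = pmat (fun i => (f i)ᴴ) := by
  ext a b
  simp [pmat, Matrix.conjTranspose_apply]

lemma pmat_smul {n : ℕ} (s : Fin n → ℂ) (f : Fin n → Matrix (Fin 2) (Fin 2) ℂ) :
    pmat (fun i => s i • f i) = (∏ i, s i) • pmat f := by
  ext a b
  simp [pmat, Finset.prod_mul_distrib]

lemma pX_sq : pauliX * pauliX = 1 := by
  ext i j; fin_cases i <;> fin_cases j <;> simp [pauliX]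
lemma pY_sq : pauliY * pauliY = 1 := by
  ext i j; fin_cases i <;> fin_cases j <;> simp [pauliY]
lemma pZ_sq : pauliZ * pauliZ = 1 := by
  ext i j; fin_cases i <;> fin_cases j <;> simp [pauliZ]
lemma pX_h : pauliXᴴ = pauliX := by
  ext i j; fin_cases i <;> fin_cases j <;> simp [pauliX]
lemma pY_h : pauliYᴴ = pauliY := by
  ext i j; fin_cases i <;> fin_cases j <;> simp [pauliY]
lemma pZ_h : pauliZᴴ = pauliZ := by
  ext i j; fin_cases i <;> fin_cases j <;> simp [pauliZ]
lemma pXZ : pauliX * pauliZ = -(pauliZ * pauliX) := by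
  ext i j; fin_cases i <;> fin_cases j <;> simp [pauliX, pauliZ]
lemma pYZ : pauliY * pauliZ = -(pauliZ * pauliY) := by
  ext i j; fin_cases i <;> fin_cases j <;> simp [pauliY, pauliZ]
lemma pXY : pauliX * pauliY = -(pauliY * pauliX) := by
  ext i j; fin_cases i <;> fin_cases j <;> simp [pauliX, pauliY]

lemma wb_eq (n k : ℕ) : weylBrauer n k = pmat (fun i : Fin n => wbFactor n k i) := rfl

lemma wb_sq (n k : ℕ) : weylBrauer n k * weylBrauer n k = 1 := by
  rw [wb_eq, pmat_mul, ← pmat_one]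
  congr 1
  funext i
  simp only [wbFactor]
  split_ifs <;> simp [pX_sq, pY_sq, pZ_sq]

lemma wb_herm (n k : ℕ) : (weylBrauer n k)ᴴ = weylBrauer n k := by
  rw [wb_eq, pmat_herm]
  congr 1
  funext i
  simp only [wbFactor]
  split_ifs <;> simp [pX_h, pY_h, pZ_h]

/-- Site of the `k`-th (0-based) Weyl–Brauer matrix. -/
def wsite (n k : ℕ) : ℕ := if k < n then k else k - n

lemma wbFactor_eq (n k i : ℕ) (hk : k < 2 * n) :
    wbFactor n (k + 1) i = if i < wsite n k then pauliZ else if i = wsite n k then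
      (if k < n then pauliX else pauliY) else 1 := by
  unfold wbFactor wsite
  by_cases h : k < n
  · have h1 : k + 1 ≤ n := h
    simp [h, h1]
  · have h1 : ¬ k + 1 ≤ n := by omega
    have h2 : k + 1 ≤ 2 * n := by omega
    have e1 : (i + 1 < k + 1 - n) ↔ i < k - n := by omega
    have e2 : (i + 1 = k + 1 - n) ↔ i = k - n := by omega
    simp only [h, h1, h2, e1, e2, if_true, if_false]

lemma wb_anti_aux (n j k : ℕ) (hj : j < 2 * n) (hk : k < 2 * n) (hjk : j ≠ k)
    (hs : wsite n j ≤ wsite n k) :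
    weylBrauer n (j + 1) * weylBrauer n (k + 1) =
      -(weylBrauer n (k + 1) * weylBrauer n (j + 1)) := by
  have hsj : wsite n j < n := by unfold wsite; split_ifs <;> omega
  rw [wb_eq, wb_eq, pmat_mul, pmat_mul]
  have key : (fun i : Fin n => wbFactor n (j + 1) i * wbFactor n (k + 1) i) =
      fun i : Fin n => (if i = ⟨wsite n j, hsj⟩ then (-1 : ℂ) else 1) •
        (wbFactor n (k + 1) i * wbFactor n (j + 1) i) := by
    funext i
    rw [wbFactor_eq n j i hj, wbFactor_eq n k i hk]
    rcases lt_trichotomy (i : ℕ) (wsite n j) with h | h | h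
    · have h1 : (i : ℕ) < wsite n k := by omega
      have h2 : i ≠ ⟨wsite n j, hsj⟩ := by
        intro h3; rw [h3] at h; simp at h
      simp [h, h1, h2]
    · have h2 : i = ⟨wsite n j, hsj⟩ := Fin.ext h
      rcases hs.lt_or_eq with h3 | h3
      · have h4 : (i : ℕ) < wsite n k := by omega
        simp only [h4, h, h2, h3, if_true, lt_irrefl, if_false]
        split_ifs <;> simp [pXZ, pYZ]
      · have h4 : ¬ ((j < n) ↔ (k < n)) := by
          unfold wsite at h3
          split_ifs at h3 <;> omega
        simp only [h, h2, h3, if_true, lt_irrefl, if_false]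
        split_ifs <;> simp_all [pXY]
    · have h2 : i ≠ ⟨wsite n j, hsj⟩ := by
        intro h3; rw [h3] at h; simp at h
      have h5 : ¬ (i : ℕ) < wsite n j := by omega
      have h6 : ¬ (i : ℕ) = wsite n j := by omega
      simp [h2, h5, h6]
  rw [key, pmat_smul]
  simp

lemma wb_anti (n j k : ℕ) (hj : j < 2 * n) (hk : k < 2 * n) (hjk : j ≠ k) :
    weylBrauer n (j + 1) * weylBrauer n (k + 1) =
      -(weylBrauer n (k + 1) * weylBrauer n (j + 1)) := by
  rcases le_total (wsite n j) (wsite n k) with h | h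
  · exact wb_anti_aux n j k hj hk hjk h
  · rw [wb_anti_aux n k j hk hj hjk.symm h, neg_neg]

lemma gammaOp_eq (n l : ℕ) (x : Fin l → ZMod 2) : gammaOp n l x =
  (Complex.I ^ tauZ x) •
    ((((List.finRange n).map fun k : Fin n =>
        weylBrauer n ((k : ℕ) + 1) ^ xcomp x (k : ℕ) *
          weylBrauer n (n + (k : ℕ) + 1) ^ xcomp x (n + (k : ℕ))).prod) *
      weylBrauer n (2 * n + 1) ^ xcomp x (2 * n)) := by
  unfold gammaOp
  congr 3
  simp only [List.bind_eq_flatMap, List.pure_def]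
  generalize List.finRange n = L
  induction L with
  | nil => rfl
  | cons a L ih => simpa using ih

lemma list_comm {n : ℕ} (x : Fin (2 * n) → ZMod 2)
    (M : Matrix (Fin n → Fin 2) (Fin n → Fin 2) ℂ) (s : ℕ → ℂ)
    (h : ∀ k < 2 * n, M * weylBrauer n (k + 1) = s k • (weylBrauer n (k + 1) * M)) :
    M * gammaOp n (2 * n) x =
      (∏ k ∈ Finset.range (2 * n), s k ^ xcomp x k) • (gammaOp n (2 * n) x * M) := by
  have hp : ∀ k < 2 * n, ∀ e : ℕ, M * weylBrauer n (k + 1) ^ e =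
      s k ^ e • (weylBrauer n (k + 1) ^ e * M) := by
    intro k hk e
    induction e with
    | zero => simp
    | succ e ih =>
      rw [pow_succ, ← mul_assoc, ih, smul_mul_assoc, mul_assoc, h k hk, mul_smul_comm, smul_smul,
        pow_succ, mul_assoc]
  have hl : ∀ l : List (Fin n), M * (l.map fun k : Fin n =>
        weylBrauer n ((k : ℕ) + 1) ^ xcomp x (k : ℕ) *
          weylBrauer n (n + (k : ℕ) + 1) ^ xcomp x (n + (k : ℕ))).prod =
      (l.map fun k : Fin n => s k ^ xcomp x k * s (n + k) ^ xcomp x (n + k)).prod •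
      ((l.map fun k : Fin n =>
        weylBrauer n ((k : ℕ) + 1) ^ xcomp x (k : ℕ) *
          weylBrauer n (n + (k : ℕ) + 1) ^ xcomp x (n + (k : ℕ))).prod * M) := by
    intro l
    induction l with
    | nil => simp
    | cons k l ih =>
      simp only [List.map_cons, List.prod_cons]
      have h1 := hp k (by omega) (xcomp x k)
      have h2 := hp (n + k) (by omega) (xcomp x (n + k))
      rw [← mul_assoc, ← mul_assoc, h1, smul_mul_assoc, mul_assoc _ M, h2, mul_smul_comm,
        smul_smul, smul_mul_assoc, mul_assoc, mul_assoc, ih]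
      simp only [mul_smul_comm, smul_smul, mul_assoc]
  have h0 : xcomp x (2 * n) = 0 := by simp [xcomp]
  rw [gammaOp_eq]
  rw [h0, pow_zero, mul_one, mul_smul_comm, hl, smul_mul_assoc, smul_comm]
  congr 1
  have hf : ∀ f : ℕ → ℂ, ∏ k ∈ Finset.range (2 * n), f k =
      ∏ k : Fin n, f k * f (n + k) := by
    intro f
    rw [two_mul, Finset.prod_range_add, Finset.prod_mul_distrib,
      Finset.prod_range, Finset.prod_range]
  rw [← List.ofFn_eq_map, List.prod_ofFn, hf]

lemma wtZ_eq {l : ℕ} (x : Fin l → ZMod 2) : wtZ x = ∑ k, (x k).val := by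
  unfold wtZ
  rw [Finset.card_filter]
  refine Finset.sum_congr rfl fun k _ => ?_
  generalize x k = y
  revert y; decide

/-- The sign of `Γ_x` under conjugation by the `k`-th generator. -/
def gsign {l : ℕ} (x : Fin l → ZMod 2) (k : Fin l) : ℂ := (-1) ^ wtZ x * (-1) ^ (x k).val

lemma prod_xcomp {l : ℕ} (x : Fin l → ZMod 2) (s : ℕ → ℂ) :
    ∏ k ∈ Finset.range l, s k ^ xcomp x k = ∏ k : Fin l, s k ^ (x k).val := by
  rw [Finset.prod_range]
  refine Finset.prod_congr rfl fun k _ => ?_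
  simp [xcomp]

lemma wb_gamma (n : ℕ) (x : Fin (2 * n) → ZMod 2) (j : Fin (2 * n)) :
    weylBrauer n (j + 1) * gammaOp n (2 * n) x =
      gsign x j • (gammaOp n (2 * n) x * weylBrauer n (j + 1)) := by
  rw [list_comm x (weylBrauer n (j + 1)) (fun k => if k = j then 1 else -1)]
  · congr 1
    rw [prod_xcomp]
    have e : ((-1 : ℂ)) ^ (x j).val = ∏ k, if k = j then (-1 : ℂ) ^ (x k).val else 1 := by simp
    unfold gsign
    rw [wtZ_eq, ← Finset.prod_pow_eq_pow_sum, e, ← Finset.prod_mul_distrib]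
    refine Finset.prod_congr rfl fun k _ => ?_
    by_cases h : k = j
    · simp [h, ← mul_pow]
    · simp [h, Fin.val_inj]
  · intro k hk
    by_cases h : k = j
    · simp [h]
    · simp only [h, if_false]
      rw [wb_anti n j k j.2 hk (Ne.symm h)]
      simp

lemma gamma_gamma (n : ℕ) (x : Fin (2 * n) → ZMod 2) :
    gammaOp n (2 * n) (fun _ => 1) * gammaOp n (2 * n) x =
      (-1 : ℂ) ^ wtZ x • (gammaOp n (2 * n) x * gammaOp n (2 * n) (fun _ => 1)) := by
  rw [list_comm x _ (fun _ => -1)]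
  · congr 1
    rw [prod_xcomp, wtZ_eq, ← Finset.prod_pow_eq_pow_sum]
  · intro k hk
    have := wb_gamma n (fun _ => 1) ⟨k, hk⟩
    have hw : wtZ (fun _ : Fin (2 * n) => (1 : ZMod 2)) = 2 * n := by simp [wtZ]
    simp only [gsign, hw] at this
    rw [this, smul_smul]
    simp [ZMod.val_one]

lemma gamma_unit (n : ℕ) (x : Fin (2 * n) → ZMod 2) :
    (gammaOp n (2 * n) x)ᴴ * gammaOp n (2 * n) x = 1 := by
  have hp : ∀ k e : ℕ, weylBrauer n k ^ e ∈ Matrix.unitaryGroup (Fin n → Fin 2) ℂ := by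
    intro k e
    refine pow_mem ?_ e
    rw [Matrix.mem_unitaryGroup_iff, Matrix.star_eq_conjTranspose, wb_herm, wb_sq]
  have h1 : (((List.finRange n).map fun k : Fin n =>
        weylBrauer n ((k : ℕ) + 1) ^ xcomp x (k : ℕ) *
          weylBrauer n (n + (k : ℕ) + 1) ^ xcomp x (n + (k : ℕ))).prod *
      weylBrauer n (2 * n + 1) ^ xcomp x (2 * n)) ∈ Matrix.unitaryGroup (Fin n → Fin 2) ℂ := by
    refine mul_mem (list_prod_mem ?_) (hp _ _)
    intro y hy
    simp only [List.mem_map] at hy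
    obtain ⟨k, -, rfl⟩ := hy
    exact mul_mem (hp _ _) (hp _ _)
  rw [Matrix.mem_unitaryGroup_iff', Matrix.star_eq_conjTranspose] at h1
  rw [gammaOp_eq]
  rw [Matrix.conjTranspose_smul, smul_mul_assoc, mul_smul_comm, h1, smul_smul]
  simp [← mul_pow]

lemma neg_one_pow_parity {a b : ℕ} (h : (-1 : ℂ) ^ a = (-1) ^ b) : a % 2 = b % 2 := by
  rcases Nat.even_or_odd a with ha | ha <;> rcases Nat.even_or_odd b with hb | hb
  · rw [Nat.even_iff.1 ha, Nat.even_iff.1 hb]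
  · rw [ha.neg_one_pow, hb.neg_one_pow] at h
    norm_num at h
  · rw [ha.neg_one_pow, hb.neg_one_pow] at h
    norm_num at h
  · rw [Nat.odd_iff.1 ha, Nat.odd_iff.1 hb]

lemma gsign_inj {n : ℕ} (x y : Fin (2 * n) → ZMod 2) (h : ∀ k, gsign x k = gsign y k) :
    x = y := by
  have hk : ∀ k, (wtZ x + (x k).val) % 2 = (wtZ y + (y k).val) % 2 := by
    intro k
    apply neg_one_pow_parity
    rw [pow_add, pow_add]
    exact h k
  have hx : ∀ k, (x k).val < 2 := fun k => ZMod.val_lt _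
  have hy : ∀ k, (y k).val < 2 := fun k => ZMod.val_lt _
  have hpar : wtZ x % 2 = wtZ y % 2 := by
    by_contra hne
    have h1 : ∀ k, (x k).val + (y k).val = 1 := by
      intro k
      have := hk k; have := hx k; have := hy k
      omega
    have h2 : wtZ x + wtZ y = 2 * n := by
      rw [wtZ_eq, wtZ_eq, ← Finset.sum_add_distrib]
      simp [h1]
    omega
  funext k
  apply ZMod.val_injective
  have := hk k; have := hx k; have := hy k
  omega

lemma gsign_or {l : ℕ} (x : Fin l → ZMod 2) (k : Fin l) : gsign x k = 1 ∨ gsign x k = -1 := by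
  unfold gsign
  rw [← pow_add]
  exact neg_one_pow_eq_or ℂ _

lemma gsign_mul {l : ℕ} (x : Fin l → ZMod 2) (k : Fin l) : gsign x k * gsign x k = 1 := by
  rcases gsign_or x k with h | h <;> simp [h]

lemma gsign_star {l : ℕ} (x : Fin l → ZMod 2) (k : Fin l) : star (gsign x k) = gsign x k := by
  rcases gsign_or x k with h | h <;> simp [h]

lemma wb_gamma_herm (n : ℕ) (x : Fin (2 * n) → ZMod 2) (j : Fin (2 * n)) :
    (gammaOp n (2 * n) x)ᴴ * weylBrauer n (j + 1) =
      gsign x j • (weylBrauer n (j + 1) * (gammaOp n (2 * n) x)ᴴ) := by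
  have := congrArg conjTranspose (wb_gamma n x j)
  rw [conjTranspose_mul, conjTranspose_smul, conjTranspose_mul, wb_herm, gsign_star] at this
  exact this

lemma orth_of_sign {n : ℕ} (x : Fin (2 * n) → ZMod 2) (k : Fin (2 * n)) (t : ℂ)
    (M : Matrix (Fin n → Fin 2) (Fin n → Fin 2) ℂ)
    (hM : weylBrauer n (k + 1) * M = t • (M * weylBrauer n (k + 1)))
    (hne : gsign x k * t ≠ 1) :
    ((gammaOp n (2 * n) x)ᴴ * M).trace = 0 := by
  have h1 : ((gammaOp n (2 * n) x)ᴴ * M).trace =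
      (gsign x k * t) * ((gammaOp n (2 * n) x)ᴴ * M).trace := by
    calc ((gammaOp n (2 * n) x)ᴴ * M).trace
        = (((gammaOp n (2 * n) x)ᴴ * weylBrauer n (k + 1)) * (weylBrauer n (k + 1) * M)).trace := by
          rw [mul_assoc, ← mul_assoc (weylBrauer n (k + 1)), wb_sq, one_mul]
      _ = (gsign x k * t) * ((weylBrauer n (k + 1) * (gammaOp n (2 * n) x)ᴴ) *
            (M * weylBrauer n (k + 1))).trace := by
          rw [wb_gamma_herm, hM, smul_mul_smul_comm, trace_smul, smul_eq_mul]
      _ = _ := by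
          congr 1
          rw [trace_mul_comm, mul_assoc, ← mul_assoc (weylBrauer n (k + 1)), wb_sq, one_mul,
            trace_mul_comm]
  have h2 : (1 - gsign x k * t) * ((gammaOp n (2 * n) x)ᴴ * M).trace = 0 := by
    linear_combination h1
  rcases mul_eq_zero.1 h2 with h | h
  · exact absurd (by linear_combination -h) hne
  · exact h

lemma orth_of_ne {n : ℕ} (x y : Fin (2 * n) → ZMod 2) (hxy : x ≠ y)
    (M : Matrix (Fin n → Fin 2) (Fin n → Fin 2) ℂ)
    (hM : ∀ k : Fin (2 * n), weylBrauer n (k + 1) * M = gsign y k • (M * weylBrauer n (k + 1))) :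
    ((gammaOp n (2 * n) x)ᴴ * M).trace = 0 := by
  have : ∃ k, gsign x k ≠ gsign y k := by
    by_contra h
    push Not at h
    exact hxy (gsign_inj x y h)
  obtain ⟨k, hk⟩ := this
  refine orth_of_sign x k _ M (hM k) ?_
  rcases gsign_or x k with h | h <;> rcases gsign_or y k with h' | h' <;> simp_all <;> norm_num

lemma gamma_trace_self (n : ℕ) (x : Fin (2 * n) → ZMod 2) :
    ((gammaOp n (2 * n) x)ᴴ * gammaOp n (2 * n) x).trace = 2 ^ n := by
  rw [gamma_unit, trace_one]
  simp

lemma gamma_trace (n : ℕ) (x y : Fin (2 * n) → ZMod 2) :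
    ((gammaOp n (2 * n) x)ᴴ * gammaOp n (2 * n) y).trace = if x = y then 2 ^ n else 0 := by
  split_ifs with h
  · rw [h, gamma_trace_self]
  · exact orth_of_ne x y h _ (wb_gamma n y)

lemma gamma_coeff (n : ℕ) (a : (Fin (2 * n) → ZMod 2) → ℂ) (y : Fin (2 * n) → ZMod 2) :
    ((gammaOp n (2 * n) y)ᴴ * ∑ x, a x • gammaOp n (2 * n) x).trace = 2 ^ n * a y := by
  rw [Finset.mul_sum, trace_sum]
  simp only [mul_smul_comm, trace_smul, gamma_trace, smul_eq_mul]
  simp [mul_comm]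

lemma gamma_expand (n : ℕ) (M : Matrix (Fin n → Fin 2) (Fin n → Fin 2) ℂ) :
    (2 ^ n : ℂ) • M = ∑ x, ((gammaOp n (2 * n) x)ᴴ * M).trace • gammaOp n (2 * n) x := by
  have hli : LinearIndependent ℂ (fun x : Fin (2 * n) → ZMod 2 => gammaOp n (2 * n) x) := by
    rw [Fintype.linearIndependent_iff]
    intro g hg y
    have := gamma_coeff n g y
    rw [hg] at this
    simpa using this
  have hcard : Fintype.card (Fin (2 * n) → ZMod 2) =
      Module.finrank ℂ (Matrix (Fin n → Fin 2) (Fin n → Fin 2) ℂ) := by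
    rw [Module.finrank_matrix]
    simp [ZMod.card, pow_mul', sq]
  have hspan := hli.span_eq_top_of_card_eq_finrank' hcard
  have hM : M ∈ Submodule.span ℂ (Set.range fun x : Fin (2 * n) → ZMod 2 => gammaOp n (2 * n) x) := by
    rw [hspan]; trivial
  rw [Submodule.mem_span_range_iff_exists_fun] at hM
  obtain ⟨a, rfl⟩ := hM
  simp only [gamma_coeff, Finset.smul_sum, smul_smul]

lemma gamma_uniq {n : ℕ} (x : Fin (2 * n) → ZMod 2)
    (M : Matrix (Fin n → Fin 2) (Fin n → Fin 2) ℂ)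
    (hM : ∀ k : Fin (2 * n), weylBrauer n (k + 1) * M = gsign x k • (M * weylBrauer n (k + 1))) :
    ∃ c : ℂ, M = c • gammaOp n (2 * n) x := by
  have h := gamma_expand n M
  rw [Finset.sum_eq_single x] at h
  · refine ⟨(2 ^ n)⁻¹ * ((gammaOp n (2 * n) x)ᴴ * M).trace, ?_⟩
    rw [mul_smul, ← h, smul_smul, inv_mul_cancel₀ (pow_ne_zero n two_ne_zero), one_smul]
  · intro y _ hy
    rw [orth_of_ne y x hy M hM, zero_smul]
  · simp

lemma gamma_uniq_unit {n : ℕ} (x : Fin (2 * n) → ZMod 2)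
    (M : Matrix (Fin n → Fin 2) (Fin n → Fin 2) ℂ) (hu : Mᴴ * M = 1)
    (hM : ∀ k : Fin (2 * n), weylBrauer n (k + 1) * M = gsign x k • (M * weylBrauer n (k + 1))) :
    ∃ c : ℂ, Complex.normSq c = 1 ∧ M = c • gammaOp n (2 * n) x := by
  obtain ⟨c, hc⟩ := gamma_uniq x M hM
  refine ⟨c, ?_, hc⟩
  rw [hc, conjTranspose_smul, smul_mul_smul_comm, gamma_unit] at hu
  have := congrFun (congrFun hu 0) 0
  simp at this
  rw [← Complex.ofReal_inj, Complex.normSq_eq_conj_mul_self]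
  simpa using this

lemma parseval (n : ℕ) (M : Matrix (Fin n → Fin 2) (Fin n → Fin 2) ℂ) :
    (2 ^ n : ℂ) * (Mᴴ * M).trace =
      ∑ x, (Complex.normSq ((gammaOp n (2 * n) x)ᴴ * M).trace : ℂ) := by
  have h := congrArg (fun X => (Mᴴ * X).trace) (gamma_expand n M)
  simp only [mul_smul_comm, trace_smul, smul_eq_mul, Finset.mul_sum, trace_sum] at h
  rw [h]
  refine Finset.sum_congr rfl fun x _ => ?_
  have : (Mᴴ * gammaOp n (2 * n) x).trace = star ((gammaOp n (2 * n) x)ᴴ * M).trace := by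
    rw [← trace_conjTranspose, conjTranspose_mul, conjTranspose_conjTranspose]
  rw [this, Complex.normSq_eq_conj_mul_self, mul_comm]
  rfl

lemma wtZ_ones (n : ℕ) : wtZ (fun _ : Fin (2 * n) => (1 : ZMod 2)) = 2 * n := by simp [wtZ]

lemma anti_comm_pair {R : Type*} [Ring R] {a b c : R} (h1 : a * c = -(c * a))
    (h2 : b * c = -(c * b)) : Commute (a * b) c := by
  unfold Commute SemiconjBy
  rw [mul_assoc, h2, mul_neg, ← mul_assoc, h1, neg_mul, neg_neg, mul_assoc]

lemma gamma_ones_sq (n : ℕ) :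
    gammaOp n (2 * n) (fun _ => 1) * gammaOp n (2 * n) (fun _ => 1) = 1 := by
  set V : Fin n → Matrix (Fin n → Fin 2) (Fin n → Fin 2) ℂ := fun k =>
    weylBrauer n ((k : ℕ) + 1) * weylBrauer n (n + (k : ℕ) + 1) with hV
  have hg : gammaOp n (2 * n) (fun _ => 1) =
      Complex.I ^ (n * (2 * n - 1)) • ((List.finRange n).map V).prod := by
    rw [gammaOp_eq]
    have h0 : xcomp (fun _ : Fin (2 * n) => (1 : ZMod 2)) (2 * n) = 0 := by simp [xcomp]
    have ht : tauZ (fun _ : Fin (2 * n) => (1 : ZMod 2)) = n * (2 * n - 1) := by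
      rw [tauZ, wtZ_ones, mul_assoc, Nat.mul_div_cancel_left _ (by norm_num)]
    rw [h0, ht, pow_zero, mul_one]
    congr 3
    funext k
    have h1 : xcomp (fun _ : Fin (2 * n) => (1 : ZMod 2)) k = 1 := by
      have : (k : ℕ) < 2 * n := by omega
      simp [xcomp, this, ZMod.val_one]
    have h2 : xcomp (fun _ : Fin (2 * n) => (1 : ZMod 2)) (n + k) = 1 := by
      have : n + (k : ℕ) < 2 * n := by omega
      simp [xcomp, this, ZMod.val_one]
    rw [h1, h2, pow_one, pow_one]
  have hc : ∀ k l, Commute (V k) (V l) := by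
    intro k l
    by_cases hkl : k = l
    · rw [hkl]
    have : (k : ℕ) ≠ l := fun h => hkl (Fin.ext h)
    refine Commute.mul_right (anti_comm_pair ?_ ?_) (anti_comm_pair ?_ ?_) <;>
      apply wb_anti <;> omega
  have hs : ∀ k, V k * V k = -1 := by
    intro k
    have h1 : weylBrauer n (n + (k : ℕ) + 1) * weylBrauer n ((k : ℕ) + 1) =
      -(weylBrauer n ((k : ℕ) + 1) * weylBrauer n (n + (k : ℕ) + 1)) := by
      apply wb_anti <;> omega
    simp only [hV]
    rw [mul_assoc, ← mul_assoc (weylBrauer n (n + (k : ℕ) + 1)), h1, neg_mul, mul_assoc, wb_sq,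
      mul_one, mul_neg, wb_sq]
  have hl : ∀ L : List (Fin n), (L.map V).prod * (L.map V).prod =
      ((-1 : ℂ) ^ L.length) • 1 := by
    intro L
    induction L with
    | nil => simp
    | cons k L ih =>
      have hcom : Commute (V k) (L.map V).prod := by
        apply Commute.list_prod_right
        intro y hy
        simp only [List.mem_map] at hy
        obtain ⟨l, -, rfl⟩ := hy
        exact hc k l
      simp only [List.map_cons, List.prod_cons, List.length_cons]
      generalize (L.map V).prod = P at ih hcom
      generalize hW : V k = W at hcom
      have hWs : W * W = -1 := by rw [← hW]; exact hs k
      calc W * P * (W * P) = W * (P * W) * P := by simp only [mul_assoc]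
        _ = (W * W) * (P * P) := by rw [← hcom.eq]; simp only [mul_assoc]
        _ = _ := by rw [hWs, ih, pow_succ]; simp
  rw [hg, smul_mul_smul_comm, hl, smul_smul, List.length_finRange, ← mul_pow, Complex.I_mul_I,
    ← pow_add]
  have : Even (n * (2 * n - 1) + n) := by
    rcases Nat.eq_zero_or_pos n with h | h
    · simp [h]
    · have : n * (2 * n - 1) + n = 2 * (n * n) := by
        obtain ⟨m, rfl⟩ : ∃ m, n = m + 1 := ⟨n - 1, by omega⟩
        have : 2 * (m + 1) - 1 = 2 * m + 1 := by omega
        rw [this]; ring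
      rw [this]; exact even_two_mul _
  rw [this.neg_one_pow, one_smul]

lemma gamma_ones_Q {n : ℕ} (σ : ℂ) (hσ : σ = 1 ∨ σ = -1)
    (Q : Matrix (Fin n → Fin 2) (Fin n → Fin 2) ℂ)
    (hrange : LinearMap.range Q.mulVecLin ≤
      LinearMap.range
        (((2 : ℂ)⁻¹ • ((1 : Matrix (Fin n → Fin 2) (Fin n → Fin 2) ℂ) +
          σ • gammaOp n (2 * n) (fun _ => 1))).mulVecLin)) :
    gammaOp n (2 * n) (fun _ => 1) * Q = σ • Q := by
  have hP : gammaOp n (2 * n) (fun _ => 1) * ((2 : ℂ)⁻¹ • ((1 : Matrix (Fin n → Fin 2) (Fin n → Fin 2) ℂ) +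
          σ • gammaOp n (2 * n) (fun _ => 1))) = σ • ((2 : ℂ)⁻¹ • ((1 : Matrix (Fin n → Fin 2) (Fin n → Fin 2) ℂ) +
          σ • gammaOp n (2 * n) (fun _ => 1))) := by
    rw [mul_smul_comm, mul_add, mul_smul_comm, gamma_ones_sq, smul_comm σ]
    rcases hσ with rfl | rfl
    · simp [add_comm]
    · simp [add_comm]
  apply Matrix.toLin'.injective
  apply LinearMap.ext
  intro v
  obtain ⟨w, hw⟩ := hrange (LinearMap.mem_range_self Q.mulVecLin v)
  simp only [Matrix.mulVecLin_apply] at hw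
  simp only [Matrix.toLin'_apply]
  rw [← Matrix.mulVec_mulVec, ← hw, Matrix.mulVec_mulVec, hP, Matrix.smul_mulVec, hw,
    Matrix.smul_mulVec]

lemma trace_rank {n : ℕ} (Q : Matrix (Fin n → Fin 2) (Fin n → Fin 2) ℂ)
    (hQidem : Q * Q = Q) : Q.trace = (Q.rank : ℂ) := by
  have h : IsIdempotentElem (Matrix.toLin' Q) := by
    unfold IsIdempotentElem
    rw [Module.End.mul_eq_comp, ← Matrix.toLin'_mul, hQidem]
  have h2 := (LinearMap.isProj_range_iff_isIdempotentElem _).2 h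
  have h3 := h2.trace
  rw [Matrix.trace_toLin'_eq] at h3
  exact h3

lemma sum_gsign {l : ℕ} (x : Fin l → ZMod 2) :
    ∑ k, gsign x k = (-1) ^ wtZ x * ((l : ℂ) - 2 * wtZ x) := by
  unfold gsign
  rw [← Finset.mul_sum]
  congr 1
  have : ∀ k, (-1 : ℂ) ^ (x k).val = 1 - 2 * ((x k).val : ℂ) := by
    intro k
    have := ZMod.val_lt (x k)
    have h : (x k).val = 0 ∨ (x k).val = 1 := by omega
    rcases h with h | h <;> rw [h] <;> norm_num
  simp only [this, Finset.sum_sub_distrib, ← Finset.mul_sum]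
  rw [wtZ_eq]
  simp

/-- Squared modulus of the expansion coefficient. -/
def ncoef {n : ℕ} (Q : Matrix (Fin n → Fin 2) (Fin n → Fin 2) ℂ) (x : Fin (2 * n) → ZMod 2) : ℝ :=
  Complex.normSq ((gammaOp n (2 * n) x)ᴴ * Q).trace

lemma ncoef_nonneg {n : ℕ} (Q : Matrix (Fin n → Fin 2) (Fin n → Fin 2) ℂ)
    (x : Fin (2 * n) → ZMod 2) : 0 ≤ ncoef Q x := Complex.normSq_nonneg _

/-- The twirl `∑ U_k Q U_k`. -/
def twirl {n : ℕ} (Q : Matrix (Fin n → Fin 2) (Fin n → Fin 2) ℂ) :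
    Matrix (Fin n → Fin 2) (Fin n → Fin 2) ℂ :=
  ∑ k : Fin (2 * n), weylBrauer n (k + 1) * Q * weylBrauer n (k + 1)

lemma ncoef_twirl {n : ℕ} (Q : Matrix (Fin n → Fin 2) (Fin n → Fin 2) ℂ)
    (x : Fin (2 * n) → ZMod 2) :
    ncoef (twirl Q) x = (2 * n - 2 * wtZ x : ℝ) ^ 2 * ncoef Q x := by
  have h : ((gammaOp n (2 * n) x)ᴴ * twirl Q).trace =
      (∑ k, gsign x k) * ((gammaOp n (2 * n) x)ᴴ * Q).trace := by
    unfold twirl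
    rw [Finset.mul_sum, trace_sum, Finset.sum_mul]
    refine Finset.sum_congr rfl fun k _ => ?_
    rw [← mul_assoc, ← mul_assoc, wb_gamma_herm, smul_mul_assoc, smul_mul_assoc, trace_smul,
      smul_eq_mul, trace_mul_comm, ← mul_assoc, ← mul_assoc, wb_sq, one_mul]
  unfold ncoef
  rw [h, sum_gsign, Complex.normSq_mul, Complex.normSq_mul]
  have h1 : Complex.normSq ((-1) ^ wtZ x) = 1 := by
    rcases neg_one_pow_eq_or ℂ (wtZ x) with h | h <;> simp [h]
  have h2 : ((2 * n : ℕ) : ℂ) - 2 * wtZ x = ((2 * n - 2 * wtZ x : ℝ) : ℂ) := by push_cast; ring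
  rw [h1, h2, Complex.normSq_ofReal]
  ring

/-- Indicator of a pair. -/
def ind2 {l : ℕ} (j k : Fin l) : Fin l → ZMod 2 := fun i => if i = j ∨ i = k then 1 else 0

lemma wt_ind2 {l : ℕ} (j k : Fin l) (h : j ≠ k) : wtZ (ind2 j k) = 2 := by
  unfold wtZ
  refine Eq.trans ?_ (Finset.card_pair h)
  congr 1
  ext i
  by_cases h1 : i = j <;> simp [ind2, h1]

lemma ind2_gamma {n : ℕ} (j k : Fin (2 * n)) (h : j ≠ k) :
    ∃ c : ℂ, Complex.normSq c = 1 ∧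
      weylBrauer n (j + 1) * weylBrauer n (k + 1) = c • gammaOp n (2 * n) (ind2 j k) := by
  apply gamma_uniq_unit
  · rw [conjTranspose_mul, wb_herm, wb_herm, mul_assoc, ← mul_assoc (weylBrauer n (j + 1)), wb_sq,
      one_mul, wb_sq]
  · intro i
    have hanti : ∀ a b : Fin (2 * n), a ≠ b → weylBrauer n (a + 1) * weylBrauer n (b + 1) =
      -(weylBrauer n (b + 1) * weylBrauer n (a + 1)) := fun a b hab =>
        wb_anti n a b a.2 b.2 (fun h => hab (Fin.ext h))
    unfold gsign
    rw [wt_ind2 j k h]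
    by_cases hj : i = j
    · subst hj
      simp only [ind2, true_or, if_true, ZMod.val_one]
      rw [mul_assoc, hanti k i h.symm]
      simp
    · by_cases hk : i = k
      · subst hk
        simp only [ind2, or_true, if_true, ZMod.val_one]
        rw [← mul_assoc, hanti i j hj]
        simp
      · simp only [ind2, hj, hk, or_false, if_false, ZMod.val_zero]
        rw [(anti_comm_pair (hanti j i (Ne.symm hj)) (hanti k i (Ne.symm hk))).eq]
        simp

lemma pair_term {n : ℕ} (Q : Matrix (Fin n → Fin 2) (Fin n → Fin 2) ℂ)
    (hQherm : Qᴴ = Q) (hQidem : Q * Q = Q)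
    (hdet : ∀ x : Fin (2 * n) → ZMod 2, wtZ x = 2 →
      ∃ ε : ℂ, Q * gammaOp n (2 * n) x * Q = ε • Q) (j k : Fin (2 * n)) (h : j ≠ k) :
    (Q.rank : ℂ) * (weylBrauer n (j + 1) * Q * weylBrauer n (j + 1) *
      (weylBrauer n (k + 1) * Q * weylBrauer n (k + 1))).trace = (ncoef Q (ind2 j k) : ℂ) := by
  obtain ⟨c, hc, hR⟩ := ind2_gamma j k h
  obtain ⟨ε, hε⟩ := hdet _ (wt_ind2 j k h)
  set G := gammaOp n (2 * n) (ind2 j k) with hG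
  have hRh : weylBrauer n (k + 1) * weylBrauer n (j + 1) = star c • Gᴴ := by
    have := congrArg conjTranspose hR
    rwa [conjTranspose_mul, wb_herm, wb_herm, conjTranspose_smul] at this
  have hcc : c * star c = 1 := by
    have := Complex.mul_conj c
    rw [hc] at this
    simpa using this
  have h1 : (weylBrauer n (j + 1) * Q * weylBrauer n (j + 1) *
      (weylBrauer n (k + 1) * Q * weylBrauer n (k + 1))).trace = ε * (Gᴴ * Q).trace := by
    calc _ = (weylBrauer n (j + 1) * (Q * (weylBrauer n (j + 1) * weylBrauer n (k + 1)) * Q *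
              weylBrauer n (k + 1))).trace := by simp only [mul_assoc]
      _ = (Q * (weylBrauer n (j + 1) * weylBrauer n (k + 1)) * Q *
              (weylBrauer n (k + 1) * weylBrauer n (j + 1))).trace := by
          rw [trace_mul_comm]; simp only [mul_assoc]
      _ = _ := by
          rw [hRh, hR, mul_smul_comm c Q G, smul_mul_assoc, smul_mul_smul_comm, hcc, one_smul, hε,
            smul_mul_assoc, trace_smul, smul_eq_mul, trace_mul_comm]
  have h2 : star (Gᴴ * Q).trace = ε * Q.rank := by
    rw [← trace_conjTranspose, conjTranspose_mul, conjTranspose_conjTranspose, hQherm,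
      ← trace_rank Q hQidem, ← smul_eq_mul (a := ε), ← trace_smul, ← hε, trace_mul_comm (Q * G), ← mul_assoc,
      hQidem]
  rw [h1, ncoef, Complex.normSq_eq_conj_mul_self, starRingEnd_apply, ← hG, h2]
  ring

lemma twirl_trace {n : ℕ} (Q : Matrix (Fin n → Fin 2) (Fin n → Fin 2) ℂ)
    (hQherm : Qᴴ = Q) (hQidem : Q * Q = Q)
    (hdet : ∀ x : Fin (2 * n) → ZMod 2, wtZ x = 2 →
      ∃ ε : ℂ, Q * gammaOp n (2 * n) x * Q = ε • Q) :
    (Q.rank : ℂ) * ((twirl Q)ᴴ * twirl Q).trace =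
      ((2 * n * (Q.rank : ℝ) ^ 2 + ∑ p ∈ (Finset.univ : Finset (Fin (2 * n))).offDiag,
        ncoef Q (ind2 p.1 p.2) : ℝ) : ℂ) := by
  have hh : (twirl Q)ᴴ = twirl Q := by
    unfold twirl
    rw [conjTranspose_sum]
    refine Finset.sum_congr rfl fun k _ => ?_
    rw [conjTranspose_mul, conjTranspose_mul, wb_herm, hQherm, mul_assoc]
  rw [hh]
  unfold twirl
  rw [Finset.sum_mul_sum, trace_sum]
  simp only [trace_sum]
  rw [← Finset.sum_product', ← Finset.diag_union_offDiag,
    Finset.sum_union (Finset.disjoint_diag_offDiag _), mul_add, Complex.ofReal_add]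
  congr 1
  · rw [Finset.sum_diag]
    have : ∀ k : Fin (2 * n), (weylBrauer n (k + 1) * Q * weylBrauer n (k + 1) *
      (weylBrauer n (k + 1) * Q * weylBrauer n (k + 1))).trace = Q.rank := by
      intro k
      rw [← trace_rank Q hQidem]
      calc _ = (weylBrauer n (k + 1) * (Q * (weylBrauer n (k + 1) * weylBrauer n (k + 1)) * Q *
              weylBrauer n (k + 1))).trace := by simp only [mul_assoc]
        _ = _ := by
          rw [wb_sq, mul_one, hQidem, trace_mul_comm, mul_assoc, wb_sq, mul_one]
    simp only [this, Finset.sum_const, Finset.card_univ, Fintype.card_fin]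
    push_cast
    simp only [nsmul_eq_mul]
    push_cast
    ring
  · rw [Finset.mul_sum, Complex.ofReal_sum]
    refine Finset.sum_congr rfl fun p hp => ?_
    rw [Finset.mem_offDiag] at hp
    exact pair_term Q hQherm hQidem hdet p.1 p.2 hp.2.2

lemma pair_sum_le {l : ℕ} (f : (Fin l → ZMod 2) → ℝ) (hf : ∀ x, 0 ≤ f x) :
    ∑ p ∈ (Finset.univ : Finset (Fin l)).offDiag, f (ind2 p.1 p.2) ≤
      2 * ∑ x with wtZ x = 2, f x := by
  rw [← Finset.sum_fiberwise_of_maps_to (s := (Finset.univ : Finset (Fin l)).offDiag)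
    (t := Finset.univ.filter fun x : Fin l → ZMod 2 => wtZ x = 2)
    (g := fun p => ind2 p.1 p.2), Finset.mul_sum]
  · refine Finset.sum_le_sum fun x hx => ?_
    rw [Finset.sum_congr rfl (g := fun _ => f x)]
    · rw [Finset.sum_const, nsmul_eq_mul]
      refine mul_le_mul_of_nonneg_right ?_ (hf x)
      have hx2 : wtZ x = 2 := by simpa using hx
      obtain ⟨a, b, hab, hs⟩ := Finset.card_eq_two.1 hx2
      have hsub : (Finset.univ : Finset (Fin l)).offDiag.filter (fun p => ind2 p.1 p.2 = x) ⊆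
          {(a, b), (b, a)} := by
        rintro ⟨c, d⟩ hp
        simp only [Finset.mem_filter, Finset.mem_offDiag] at hp
        obtain ⟨⟨-, -, hcd⟩, rfl⟩ := hp
        have hc : c ∈ ({a, b} : Finset (Fin l)) := by rw [← hs]; simp [ind2]
        have hd : d ∈ ({a, b} : Finset (Fin l)) := by rw [← hs]; simp [ind2]
        simp only [Finset.mem_insert, Finset.mem_singleton] at hc hd
        rcases hc with rfl | rfl <;> rcases hd with rfl | rfl <;> simp_all
      have := (Finset.card_le_card hsub).trans Finset.card_le_two
      exact_mod_cast this
    · intro p hp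
      rw [(Finset.mem_filter.1 hp).2]
  · intro p hp
    rw [Finset.mem_offDiag] at hp
    simp [wt_ind2 p.1 p.2 hp.2.2]

lemma wtZ_zero (l : ℕ) : wtZ (0 : Fin l → ZMod 2) = 0 := by simp [wtZ]

lemma val_compl (y : ZMod 2) : (1 + y).val + y.val = 1 := by
  revert y; decide

lemma wtZ_compl {l : ℕ} (x : Fin l → ZMod 2) : wtZ (1 + x) + wtZ x = l := by
  rw [wtZ_eq, wtZ_eq, ← Finset.sum_add_distrib]
  simp [val_compl]

lemma ncoef_of_eq {n : ℕ} (Q M : Matrix (Fin n → Fin 2) (Fin n → Fin 2) ℂ)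
    (x : Fin (2 * n) → ZMod 2) (hu : Mᴴ * M = 1)
    (hM : ∀ k : Fin (2 * n), weylBrauer n (k + 1) * M = gsign x k • (M * weylBrauer n (k + 1))) :
    ncoef Q x = Complex.normSq (Mᴴ * Q).trace := by
  obtain ⟨c, hc, rfl⟩ := gamma_uniq_unit x M hu hM
  rw [conjTranspose_smul, smul_mul_assoc, trace_smul, smul_eq_mul, Complex.normSq_mul]
  have : Complex.normSq (star c) = 1 := by
    rw [← hc]; exact Complex.normSq_conj c
  rw [this, one_mul]
  rfl

lemma ncoef_zero {n : ℕ} (Q : Matrix (Fin n → Fin 2) (Fin n → Fin 2) ℂ)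
    (hQidem : Q * Q = Q) : ncoef Q 0 = (Q.rank : ℝ) ^ 2 := by
  rw [ncoef_of_eq Q 1 0 (by simp)]
  · rw [conjTranspose_one, one_mul, trace_rank Q hQidem, Complex.normSq_natCast, sq]
  · intro k
    simp [gsign, wtZ_zero]

lemma gamma_ones_herm_Q {n : ℕ} (σ : ℂ) (hσ : σ = 1 ∨ σ = -1)
    (Q : Matrix (Fin n → Fin 2) (Fin n → Fin 2) ℂ)
    (h : gammaOp n (2 * n) (fun _ => 1) * Q = σ • Q) :
    (gammaOp n (2 * n) (fun _ => 1))ᴴ * Q = σ • Q := by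
  have h1 : (gammaOp n (2 * n) (fun _ => 1))ᴴ * (gammaOp n (2 * n) (fun _ => 1) * Q) = Q := by
    rw [← mul_assoc, gamma_unit, one_mul]
  rw [h, mul_smul_comm] at h1
  rcases hσ with rfl | rfl
  · simpa using h1
  · simpa [neg_eq_iff_eq_neg] using h1

lemma ncoef_compl {n : ℕ} (σ : ℂ) (hσ : σ = 1 ∨ σ = -1)
    (Q : Matrix (Fin n → Fin 2) (Fin n → Fin 2) ℂ)
    (h : gammaOp n (2 * n) (fun _ => 1) * Q = σ • Q) (x : Fin (2 * n) → ZMod 2) :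
    ncoef Q (1 + x) = ncoef Q x := by
  rw [ncoef_of_eq Q (gammaOp n (2 * n) (fun _ => 1) * gammaOp n (2 * n) x) (1 + x)]
  · rw [conjTranspose_mul, mul_assoc, gamma_ones_herm_Q σ hσ Q h, mul_smul_comm, trace_smul,
      smul_eq_mul, Complex.normSq_mul]
    have : Complex.normSq σ = 1 := by rcases hσ with rfl | rfl <;> simp
    rw [this, one_mul]
    rfl
  · rw [conjTranspose_mul, mul_assoc, ← mul_assoc (gammaOp n (2 * n) fun _ => 1)ᴴ, gamma_unit,
      one_mul, gamma_unit]
  · intro k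
    rw [← mul_assoc, wb_gamma, smul_mul_assoc, mul_assoc, wb_gamma, mul_smul_comm, smul_smul,
      mul_assoc]
    congr 1
    unfold gsign
    have h1 := wtZ_compl x
    have h2 := val_compl (x k)
    rw [wtZ_ones, ZMod.val_one, ← pow_add, ← pow_add, ← pow_add, ← pow_add, Pi.add_apply,
      Pi.one_apply]
    apply neg_one_pow_congr
    rw [Nat.even_iff, Nat.even_iff]
    omega

lemma ncoef_odd {n : ℕ} (σ : ℂ) (hσ : σ = 1 ∨ σ = -1)
    (Q : Matrix (Fin n → Fin 2) (Fin n → Fin 2) ℂ) (hQherm : Qᴴ = Q)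
    (h : gammaOp n (2 * n) (fun _ => 1) * Q = σ • Q) (x : Fin (2 * n) → ZMod 2)
    (hx : Odd (wtZ x)) : ncoef Q x = 0 := by
  set G := gammaOp n (2 * n) x with hG
  set E := gammaOp n (2 * n) (fun _ => 1) with hE
  have hss : σ * σ = 1 := by rcases hσ with rfl | rfl <;> simp
  have hst : star σ = σ := by rcases hσ with rfl | rfl <;> simp
  have hQE : Q * E = σ • Q := by
    have := congrArg conjTranspose (gamma_ones_herm_Q σ hσ Q h)
    rwa [conjTranspose_mul, conjTranspose_conjTranspose, hQherm, conjTranspose_smul, hQherm,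
      hst] at this
  have ha : E * G = -(G * E) := by
    rw [hE, hG, gamma_gamma, hx.neg_one_pow]; simp
  have h1 : (Q * G).trace = -(Q * G).trace := by
    calc (Q * G).trace = (σ * σ) * (Q * G).trace := by rw [hss, one_mul]
      _ = σ * ((Q * E) * G).trace := by
          rw [hQE, smul_mul_assoc, trace_smul, smul_eq_mul, mul_assoc]
      _ = -(σ * (Q * G * E).trace) := by
          rw [mul_assoc, ha, mul_neg, trace_neg, mul_neg, mul_assoc]
      _ = -(Q * G).trace := by
          rw [trace_mul_comm, ← mul_assoc, h, smul_mul_assoc, trace_smul, smul_eq_mul, ← mul_assoc,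
            hss, one_mul]
  have h2 : (Q * G).trace = 0 := self_eq_neg.1 h1
  have h3 : (Gᴴ * Q).trace = star (Q * G).trace := by
    rw [← trace_conjTranspose, conjTranspose_mul, hQherm]
  rw [ncoef, ← hG, h3, h2]
  simp

lemma half_sum {n : ℕ} (hn : 4 ≤ n) (g : (Fin (2 * n) → ZMod 2) → ℝ) (hg : ∀ x, 0 ≤ g x)
    (hc : ∀ x, g (1 + x) = g x) :
    2 * (g 0 + ∑ x with wtZ x = 2, g x) ≤ ∑ x, g x := by
  set S : Finset (Fin (2 * n) → ZMod 2) :=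
    insert 0 (Finset.univ.filter fun x : Fin (2 * n) → ZMod 2 => wtZ x = 2) with hS
  have hSsum : ∑ x ∈ S, g x = g 0 + ∑ x with wtZ x = 2, g x := by
    rw [hS, Finset.sum_insert]
    simp [wtZ_zero]
  have hSw : ∀ x ∈ S, wtZ x ≤ 2 := by
    intro x hx
    simp only [hS, Finset.mem_insert, Finset.mem_filter, Finset.mem_univ, true_and] at hx
    rcases hx with rfl | hx
    · simp [wtZ_zero]
    · exact hx.le
  have himg : ∑ x ∈ S.image (fun x => 1 + x), g x = ∑ x ∈ S, g x := by
    rw [Finset.sum_image (fun a _ b _ hab => add_left_cancel hab)]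
    exact Finset.sum_congr rfl fun x _ => hc x
  have hdisj : Disjoint S (S.image (fun x => 1 + x)) := by
    rw [Finset.disjoint_left]
    intro x hx hx'
    obtain ⟨y, hy, rfl⟩ := Finset.mem_image.1 hx'
    have := hSw _ hx
    have := hSw _ hy
    have := wtZ_compl y
    omega
  calc 2 * (g 0 + ∑ x with wtZ x = 2, g x)
      = ∑ x ∈ S ∪ S.image (fun x => 1 + x), g x := by
        rw [Finset.sum_union hdisj, himg, hSsum]; ring
    _ ≤ ∑ x, g x := Finset.sum_le_sum_of_subset_of_nonneg (Finset.subset_univ _)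
        fun x _ _ => hg x

lemma final_even (n K A T : ℝ) (hn : 4 ≤ n) (hK : 0 < K) (hA : 0 ≤ A)
    (h : K * (2 * (4 * n ^ 2 * K ^ 2 + 4 * (n - 2) ^ 2 * A)) ≤ T * (2 * n * K ^ 2 + 2 * A)) :
    4 * (n * K) ≤ T := by
  have hpos : 0 < n * K ^ 2 + A := by positivity
  have h1 : 0 ≤ K * A * ((n - 2) ^ 2 - n) := by
    refine mul_nonneg (by positivity) ?_
    nlinarith
  have h2 : 0 ≤ (T - 4 * (n * K)) * (n * K ^ 2 + A) := by nlinarith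
  have := nonneg_of_mul_nonneg_left h2 hpos
  linarith

lemma final_odd (n K A T : ℝ) (hn : 5 ≤ n) (hK : 0 < K) (hA : 0 ≤ A)
    (h : K * (2 * ((4 * n ^ 2 - 4) * K ^ 2 + (4 * (n - 2) ^ 2 - 4) * A)) ≤
      T * (2 * n * K ^ 2 + 2 * A) - 4 * T * K ^ 2) :
    4 * ((n ^ 2 - 1) * K) ≤ (n - 2) * T := by
  have hpos : 0 < (n - 2) * K ^ 2 + A := by
    have : 0 < n - 2 := by linarith
    positivity
  have h1 : 0 ≤ K * A * ((n - 1) * ((n - 3) * (n - 2) - (n + 1))) := by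
    refine mul_nonneg (by positivity) (mul_nonneg (by linarith) ?_)
    nlinarith
  have h0 : 0 ≤ (n - 2) * (T * (2 * n * K ^ 2 + 2 * A) - 4 * T * K ^ 2 -
    K * (2 * ((4 * n ^ 2 - 4) * K ^ 2 + (4 * (n - 2) ^ 2 - 4) * A))) :=
    mul_nonneg (by linarith) (by linarith)
  have h2 : 0 ≤ ((n - 2) * T - 4 * ((n ^ 2 - 1) * K)) * ((n - 2) * K ^ 2 + A) := by
    linear_combination (1 / 2 : ℝ) * h0 + 4 * h1
  have := nonneg_of_mul_nonneg_left h2 hpos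
  linarith

open scoped ComplexOrder in
lemma eq_zero_of_trace {n : ℕ} (Q : Matrix (Fin n → Fin 2) (Fin n → Fin 2) ℂ)
    (h : (Qᴴ * Q).trace = 0) : Q = 0 :=
  Matrix.trace_conjTranspose_mul_self_eq_zero_iff.1 h

/-- Distance-2 bound for the `𝔰𝔬(2n)` semispinorial quantum metrics: let
`P_± = (I ± Γ_{1_{2n}})/2`.  If `Q` is a nonzero orthogonal projection on
`(ℂ²)^{⊗n}` whose range is contained in the range of `P_+` (or `P_−`), and `Q`
detects every `Γ_x` with `x ∈ F₂^{2n}` of weight `2`, then `n · rank Q ≤ 2^{n−2}`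
when `n` is even and `(n² − 1) · rank Q ≤ (n − 2) · 2^{n−2}` when `n` is odd. -/
theorem semispinorial_distance_two_bound (n : ℕ) (hn : 4 ≤ n)
    (σ : ℂ) (hσ : σ = 1 ∨ σ = -1)
    (Q : Matrix (Fin n → Fin 2) (Fin n → Fin 2) ℂ)
    (hQherm : Qᴴ = Q) (hQidem : Q * Q = Q) (hQne : Q ≠ 0)
    (hrange : LinearMap.range Q.mulVecLin ≤
      LinearMap.range
        (((2 : ℂ)⁻¹ • ((1 : Matrix (Fin n → Fin 2) (Fin n → Fin 2) ℂ) +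
          σ • gammaOp n (2 * n) (fun _ => 1))).mulVecLin))
    (hdet : ∀ x : Fin (2 * n) → ZMod 2, wtZ x = 2 →
      ∃ ε : ℂ, Q * gammaOp n (2 * n) x * Q = ε • Q) :
    (Even n → n * Q.rank ≤ 2 ^ (n - 2)) ∧
    (¬ Even n → (n ^ 2 - 1) * Q.rank ≤ (n - 2) * 2 ^ (n - 2)) := by
  have hE := gamma_ones_Q σ hσ Q hrange
  have hKpos : 0 < Q.rank := by
    rw [Nat.pos_iff_ne_zero]
    intro h0
    have h1 := trace_rank Q hQidem
    rw [h0, Nat.cast_zero] at h1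
    apply hQne
    exact eq_zero_of_trace Q (by rw [hQherm, hQidem, h1])
  have hK : (0 : ℝ) < Q.rank := by exact_mod_cast hKpos
  set K : ℝ := (Q.rank : ℝ) with hKdef
  set A : ℝ := ∑ x with wtZ x = 2, ncoef Q x with hAdef
  have hA : 0 ≤ A := Finset.sum_nonneg fun x _ => ncoef_nonneg Q x
  have hsum : ∑ x, ncoef Q x = 2 ^ n * K := by
    have := parseval n Q
    rw [hQherm, hQidem, trace_rank Q hQidem] at this
    have h2 : (∑ x, (ncoef Q x : ℂ)) = (2 : ℂ) ^ n * (Q.rank : ℂ) := this.symm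
    rw [hKdef]
    exact_mod_cast h2
  have hsum2 : K * ∑ x, (2 * n - 2 * wtZ x : ℝ) ^ 2 * ncoef Q x ≤
      2 ^ n * (2 * n * K ^ 2 + 2 * A) := by
    have h1 := parseval n (twirl Q)
    have h2 := twirl_trace Q hQherm hQidem hdet
    have h3 : (∑ x, (ncoef (twirl Q) x : ℂ)) = 2 ^ n * ((twirl Q)ᴴ * twirl Q).trace := h1.symm
    have h4 : K * ∑ x, ncoef (twirl Q) x = 2 ^ n * (2 * n * K ^ 2 +
        ∑ p ∈ (Finset.univ : Finset (Fin (2 * n))).offDiag, ncoef Q (ind2 p.1 p.2)) := by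
      apply Complex.ofReal_injective
      rw [Complex.ofReal_mul, Complex.ofReal_mul, ← h2, Complex.ofReal_sum, h3]
      simp only [hKdef, Complex.ofReal_natCast, Complex.ofReal_pow, Complex.ofReal_ofNat]
      ring
    simp only [ncoef_twirl] at h4
    rw [h4]
    have h5 := pair_sum_le (ncoef Q) (ncoef_nonneg Q)
    gcongr
  have hpow : (2 : ℝ) ^ n = 4 * 2 ^ (n - 2) := by
    have : n = (n - 2) + 2 := by omega
    conv_lhs => rw [this, pow_add]
    ring
  have hpowN : (2 : ℕ) ^ n = 4 * 2 ^ (n - 2) := by exact_mod_cast hpow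
  -- symmetric lower bound
  have hlow : ∀ δ : ℝ, (∀ x, 0 ≤ ((2 * n - 2 * wtZ x : ℝ) ^ 2 - δ) * ncoef Q x) →
      2 * ((4 * n ^ 2 - δ) * K ^ 2 + (4 * ((n : ℝ) - 2) ^ 2 - δ) * A) ≤
        ∑ x, (2 * n - 2 * wtZ x : ℝ) ^ 2 * ncoef Q x - δ * (2 ^ n * K) := by
    intro δ hδ
    have h1 := half_sum hn (fun x => ((2 * n - 2 * wtZ x : ℝ) ^ 2 - δ) * ncoef Q x) hδ (by
      intro x
      have hw : (wtZ (1 + x) : ℝ) + wtZ x = 2 * n := by exact_mod_cast wtZ_compl x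
      have hw' : (wtZ (1 + x) : ℝ) = 2 * n - wtZ x := by linarith
      simp only [ncoef_compl σ hσ Q hE x, hw']
      ring)
    have h2 : ∑ x with wtZ x = 2, ((2 * n - 2 * wtZ x : ℝ) ^ 2 - δ) * ncoef Q x =
        (4 * ((n : ℝ) - 2) ^ 2 - δ) * A := by
      rw [hAdef, Finset.mul_sum]
      refine Finset.sum_congr rfl fun x hx => ?_
      rw [(Finset.mem_filter.1 hx).2]
      push_cast
      ring
    rw [h2] at h1
    have h3 : ∑ x, ((2 * n - 2 * wtZ x : ℝ) ^ 2 - δ) * ncoef Q x =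
        ∑ x, (2 * n - 2 * wtZ x : ℝ) ^ 2 * ncoef Q x - δ * (2 ^ n * K) := by
      rw [← hsum, Finset.mul_sum, ← Finset.sum_sub_distrib]
      exact Finset.sum_congr rfl fun x _ => by ring
    rw [h3, wtZ_zero, ncoef_zero Q hQidem, ← hKdef] at h1
    refine le_trans (le_of_eq ?_) h1
    push_cast
    ring
  have hn4 : (4 : ℝ) ≤ n := by exact_mod_cast hn
  constructor
  · intro _
    have h1 := hlow 0 (fun x => mul_nonneg (by rw [sub_zero]; positivity) (ncoef_nonneg Q x))
    have h2 := final_even n K A (2 ^ n) hn4 hK hA (by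
      refine le_trans ?_ hsum2
      refine mul_le_mul_of_nonneg_left ?_ hK.le
      simpa using h1)
    rw [hpow] at h2
    have h3 : (n : ℝ) * K ≤ 2 ^ (n - 2) := by linarith
    rw [hKdef] at h3
    exact_mod_cast h3
  · intro hodd
    rw [Nat.not_even_iff_odd] at hodd
    have hn5 : (5 : ℝ) ≤ n := by
      have : n ≠ 4 := by rintro rfl; exact absurd hodd (by decide)
      have : 5 ≤ n := by omega
      exact_mod_cast this
    have h1 := hlow 4 (by
      intro x
      rcases Nat.even_or_odd (wtZ x) with hx | hx
      · refine mul_nonneg ?_ (ncoef_nonneg Q x)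
        have hz : ((n : ℤ) - wtZ x) ≠ 0 := by
          intro h
          have : n = wtZ x := by omega
          rw [this] at hodd
          exact (Nat.not_even_iff_odd.2 hodd) hx
        have hz2 : (1 : ℤ) ≤ ((n : ℤ) - wtZ x) ^ 2 := by
          have := sq_nonneg ((n : ℤ) - wtZ x)
          have := pow_ne_zero 2 hz
          omega
        have hz3 : (1 : ℝ) ≤ ((n : ℝ) - wtZ x) ^ 2 := by exact_mod_cast hz2
        nlinarith
      · rw [ncoef_odd σ hσ Q hQherm hE x hx, mul_zero])
    have h2 := final_odd n K A (2 ^ n) hn5 hK hA (by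
      have := mul_le_mul_of_nonneg_left h1 hK.le
      rw [mul_sub] at this
      refine this.trans ?_
      nlinarith)
    rw [hpow] at h2
    have h3 : ((n : ℝ) ^ 2 - 1) * K ≤ ((n : ℝ) - 2) * 2 ^ (n - 2) := by linarith
    rw [hKdef] at h3
    have e1 : ((n ^ 2 - 1 : ℕ) : ℝ) = (n : ℝ) ^ 2 - 1 := by
      rw [Nat.cast_sub (Nat.one_le_pow _ _ (by omega))]; push_cast; ring
    have e2 : ((n - 2 : ℕ) : ℝ) = (n : ℝ) - 2 := by
      rw [Nat.cast_sub (by omega)]; push_cast; ring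
    rw [← e1, ← e2] at h3
    exact_mod_cast h3

end
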